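/- (Alternative expression for e_{m,n}) Let m, n ≥ 1 with m + n ≥ 3 and let r satisfy 1 ≤ r ≤ min(m,n) and r < max(m,n). Then e_{m,n} = (−1)^r · (t_m ⊗ t_n) ∘ (t_{m−r} ⊗ (Cu_r ∘ Ca_r) ⊗ t_{n−r}) ∘ (t_m ⊗ t_n) in End(V^{⊗(m+n)}), where t_{m−r} acts on the first m−r factors, Cu_r ∘ Ca_r on the middle 2r factors, t_{n−r} on the last n−r factors, and a factor t₀ on zero tensor factors is interpreted as the identity (i.e. omitted). -/

import Mathlib

open Matrix

noncomputable section

/-- Sign strings `ε ∈ {+,-}^m`; `true` encodes `+` and `false` encodes `-`. -/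
abbrev Sgn (m : ℕ) := Fin m → Bool

/-- Endomorphisms of `V^{⊗m}` (`V = ℂ²`), as matrices indexed by sign strings. -/
abbrev Op (m : ℕ) := Matrix (Sgn m) (Sgn m) ℂ

/-- Linear maps `V^{⊗m} → V^{⊗n}`, as matrices (rows: target, columns: source). -/
abbrev Mor (m n : ℕ) := Matrix (Sgn n) (Sgn m) ℂ

/-- The basis vector `v_ε` of `V^{⊗m}`. -/
def bv {m : ℕ} (ε : Sgn m) : Sgn m → ℂ := fun δ => if δ = ε then 1 else 0

/-- The coefficient of `cap` on `v_a ⊗ v_b`: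
`cap (v₋ ⊗ v₊) = 1`, `cap (v₊ ⊗ v₋) = -1`, `cap (v₊ ⊗ v₊) = cap (v₋ ⊗ v₋) = 0`. -/
def capc (a b : Bool) : ℂ := if a then (if b then 0 else -1) else (if b then 1 else 0)

/-- The coefficient of `v_a ⊗ v_b` in `cup 1 = v₊ ⊗ v₋ - v₋ ⊗ v₊`. -/
def cupc (a b : Bool) : ℂ := if a then (if b then 0 else 1) else (if b then -1 else 0)

/-- The cap `V ⊗ V → ℂ`. -/
def capM : Mor 2 0 := Matrix.of fun _ ε => capc (ε 0) (ε 1)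

/-- The cup `ℂ → V ⊗ V`. -/
def cupM : Mor 0 2 := Matrix.of fun δ _ => cupc (δ 0) (δ 1)

/-- The tensor product of two linear maps. -/
def tensMor {a b c d : ℕ} (A : Mor a b) (B : Mor c d) : Mor (a + c) (b + d) :=
  Matrix.of fun δ ε =>
    A (fun i => δ (Fin.castAdd d i)) (fun i => ε (Fin.castAdd c i)) *
      B (fun j => δ (Fin.natAdd b j)) (fun j => ε (Fin.natAdd a j))

/-- The swap of the two tensor factors of `V ⊗ V`. -/
def swap2 : Op 2 := Matrix.of fun δ ε => if δ 0 = ε 1 ∧ δ 1 = ε 0 then 1 else 0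

/-- `id^{⊗p} ⊗ A ⊗ id^{⊗(m-p-2)}`: the operator `A` on two strands placed at the
(0-based) positions `p`, `p+1` among `m` strands. -/
def atPos (m p : ℕ) (A : Op 2) : Op m :=
  Matrix.of fun δ ε =>
    if h : p + 2 ≤ m then
      (if ∀ k : Fin m, k.val ≠ p → k.val ≠ p + 1 → δ k = ε k then 1 else 0) *
        A (fun i => δ ⟨p + i.val, Nat.lt_of_lt_of_le (Nat.add_lt_add_left i.isLt p) h⟩)
          (fun i => ε ⟨p + i.val, Nat.lt_of_lt_of_le (Nat.add_lt_add_left i.isLt p) h⟩)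
    else 0

/-- Cyclic rotation of sign strings: `(rotIdx δ) k = δ (k+1 mod m)`. -/
def rotIdx {m : ℕ} (δ : Sgn m) : Sgn m := fun k => δ ⟨(k.val + 1) % m, Nat.mod_lt _ k.pos⟩

/-- The rotation `d_m : V^{⊗m} → V^{⊗m}`, `d_m (v_ε ⊗ w) = i^{ε} (w ⊗ v_ε)`. -/
def dRot : (m : ℕ) → Op m
  | 0 => 1
  | (m + 1) =>
    Matrix.of fun δ' δ =>
      if δ' = rotIdx δ then (if δ 0 then Complex.I else -Complex.I) else 0

/-- The cap-cup generator `u_j` (`j` is 1-based, `1 ≤ j ≤ m-1`);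
`u_0 := d_m⁻¹ ∘ u_1 ∘ d_m` is the affine generator. -/
def uFull (m j : ℕ) : Op m :=
  if j = 0 then (dRot m)⁻¹ * atPos m 0 (cupM * capM) * dRot m
  else atPos m (j - 1) (cupM * capM)

/-- The extremal weight projectors `t_m`, defined by `t₁ = id`,
`t₂ = id + u₁/2 + u₀/2`, and `t_{m+1} = (t_m ⊗ id) ∘ σ_m ∘ (t_m ⊗ id)` for `m ≥ 2`
(with the convention `t₀ = 2·id`). -/
def tP : (m : ℕ) → Op m
  | 0 => (2 : ℂ) • 1
  | 1 => 1
  | 2 => 1 + (2⁻¹ : ℂ) • atPos 2 0 (cupM * capM) +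
      (2⁻¹ : ℂ) • ((dRot 2)⁻¹ * atPos 2 0 (cupM * capM) * dRot 2)
  | (m + 3) =>
    tensMor (tP (m + 2)) (1 : Op 1) * atPos (m + 3) (m + 1) swap2 *
      tensMor (tP (m + 2)) (1 : Op 1)

/-- `n` nested caps `Ca_n : V^{⊗2n} → ℂ`. -/
def CaM (n : ℕ) : Mor (n + n) 0 :=
  Matrix.of fun _ δ =>
    ∏ k : Fin n,
      capc (δ ⟨k.val, Nat.lt_of_lt_of_le k.isLt (Nat.le_add_right n n)⟩)
        (δ ⟨n + n - 1 - k.val,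
          Nat.lt_of_le_of_lt (Nat.sub_le _ _)
            (Nat.sub_lt (Nat.lt_of_lt_of_le k.pos (Nat.le_add_right n n)) Nat.one_pos)⟩)

/-- `n` nested cups `Cu_n : ℂ → V^{⊗2n}`. -/
def CuM (n : ℕ) : Mor 0 (n + n) :=
  Matrix.of fun δ _ =>
    ∏ k : Fin n,
      cupc (δ ⟨k.val, Nat.lt_of_lt_of_le k.isLt (Nat.le_add_right n n)⟩)
        (δ ⟨n + n - 1 - k.val,
          Nat.lt_of_le_of_lt (Nat.sub_le _ _)
            (Nat.sub_lt (Nat.lt_of_lt_of_le k.pos (Nat.le_add_right n n)) Nat.one_pos)⟩)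

/-- The canonical identification of sign strings induced by an equality of lengths. -/
def sgnCast {a b : ℕ} (h : a = b) : Sgn a ≃ Sgn b :=
  Equiv.arrowCongr (finCongr h) (Equiv.refl Bool)

/-- Reindexing of a linear map along equalities of the numbers of strands. -/
def rc {a b c d : ℕ} (h1 : a = b) (h2 : c = d) (A : Mor a c) : Mor b d :=
  Matrix.reindex (sgnCast h2) (sgnCast h1) A

/-- The idempotents `e_{m,n}`:
`e_{1,1} = -u₁/2 - d₂⁻¹ ∘ u₁ ∘ d₂ / 2` and
`e_{m,n} = -(t_m ⊗ t_n) ∘ u_m ∘ (t_m ⊗ t_n)` otherwise. -/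
def eP : (m n : ℕ) → Op (m + n)
  | 1, 1 =>
    (-(2⁻¹ : ℂ)) • atPos 2 0 (cupM * capM) +
      (-(2⁻¹ : ℂ)) • ((dRot 2)⁻¹ * atPos 2 0 (cupM * capM) * dRot 2)
  | m, n =>
    -(tensMor (tP m) (tP n) * atPos (m + n) (m - 1) (cupM * capM) * tensMor (tP m) (tP n))

/-- A copy of `t_k` in which `t₀` is interpreted as the identity (omitted factor). -/
def tHat : (k : ℕ) → Op k
  | 0 => 1
  | (k + 1) => tP (k + 1)

/-- The projector onto the span of the `v_ε` with `ε` a constant sign string. -/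
def constProj (m : ℕ) : Op m :=
  Matrix.diagonal fun ε => if ∀ i j, ε i = ε j then 1 else 0

/-- The sign string `a^m b^n`. -/
def blockSgn (m n : ℕ) (a b : Bool) : Sgn (m + n) := fun i => if i.val < m then a else b

lemma tensMor_diagonal {m n : ℕ} (f : Sgn m → ℂ) (g : Sgn n → ℂ) :
    tensMor (Matrix.diagonal f) (Matrix.diagonal g) =
      Matrix.diagonal fun ε : Sgn (m + n) =>
        f (fun i => ε (Fin.castAdd n i)) * g (fun j => ε (Fin.natAdd m j)) := by
  ext δ ε
  simp only [tensMor, Matrix.of_apply, Matrix.diagonal_apply]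
  by_cases h : δ = ε
  · subst h; simp
  · rw [if_neg h]
    by_contra hne
    obtain ⟨h1, h2⟩ := mul_ne_zero_iff.mp hne
    have h1' := (ite_ne_right_iff.mp h1).1
    have h2' := (ite_ne_right_iff.mp h2).1
    exact h (funext (Fin.addCases (congrFun h1') (congrFun h2')))

lemma dRot_two_inv : (dRot 2)⁻¹ = Matrix.of fun δ' δ : Sgn 2 =>
    if δ = rotIdx δ' then (if δ' 0 then -Complex.I else Complex.I) else 0 := by
  apply Matrix.inv_eq_right_inv
  ext δ ε
  obtain ⟨⟨a, b⟩, rfl⟩ := (finTwoArrowEquiv Bool).symm.surjective δ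
  obtain ⟨⟨c, d⟩, rfl⟩ := (finTwoArrowEquiv Bool).symm.surjective ε
  rw [Matrix.mul_apply, ← (finTwoArrowEquiv Bool).symm.sum_comp, Fintype.sum_prod_type]
  cases a <;> cases b <;> cases c <;> cases d <;>
    simp [dRot, rotIdx, funext_iff, Fin.forall_fin_two]

lemma atPos_two (A : Op 2) : atPos 2 0 A = A := by
  ext δ ε
  simp [atPos]

lemma tP_two : tP 2 = constProj 2 := by
  ext δ ε
  obtain ⟨⟨a, b⟩, rfl⟩ := (finTwoArrowEquiv Bool).symm.surjective δ
  obtain ⟨⟨c, d⟩, rfl⟩ := (finTwoArrowEquiv Bool).symm.surjective ε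
  simp only [tP, dRot_two_inv, atPos_two, constProj, Matrix.add_apply, Matrix.smul_apply,
    Matrix.mul_apply, ← (finTwoArrowEquiv Bool).symm.sum_comp, Fintype.sum_prod_type]
  cases a <;> cases b <;> cases c <;> cases d <;>
    simp [dRot, rotIdx, cupM, capM, cupc, capc, funext_iff, Fin.forall_fin_two] <;> norm_num

lemma constProj_apply {m : ℕ} (δ ε : Sgn m) :
    constProj m δ ε = if δ = ε ∧ ∀ i j, δ i = δ j then 1 else 0 := by
  rw [constProj, Matrix.diagonal_apply, ite_and]

lemma constProj_eq_one {m : ℕ} (hm : m ≤ 1) : constProj m = 1 := by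
  rw [constProj, ← Matrix.diagonal_one]
  congr 1
  funext ε
  refine if_pos fun i j => congrArg ε (Fin.ext ?_)
  omega

lemma exists_eq_const_iff {m : ℕ} (ε : Sgn m) :
    (∀ i j, ε i = ε j) ↔ ∃ a, ∀ i, ε i = a := by
  refine ⟨fun h => ?_, fun ⟨a, h⟩ i j => (h i).trans (h j).symm⟩
  cases m with
  | zero => exact ⟨true, fun i => i.elim0⟩
  | succ m => exact ⟨ε 0, fun i => h i 0⟩

lemma tP_succ (m : ℕ) : tP (m + 1) = constProj (m + 1) := by
  induction m with
  | zero => rw [constProj_eq_one le_rfl, tP]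
  | succ m ih =>
    cases m with
    | zero => exact tP_two
    | succ m =>
      rw [tP, ih, ← Matrix.diagonal_one, constProj, tensMor_diagonal]
      ext δ ε
      rw [Matrix.mul_diagonal, Matrix.diagonal_mul, constProj_apply]
      simp only [atPos, swap2, Matrix.of_apply, le_refl, dite_true]
      by_cases h : δ = ε ∧ ∀ i j, δ i = δ j
      · obtain ⟨rfl, h⟩ := h
        obtain ⟨a, ha⟩ := (exists_eq_const_iff δ).mp h
        simp [ha]
      · rw [if_neg h]
        by_contra hne
        simp only [ne_eq, mul_eq_zero, not_or, ite_eq_right_iff, one_ne_zero, imp_false,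
          not_not, not_false_eq_true, and_true] at hne
        obtain ⟨⟨h1, h2, h3, h4⟩, h5⟩ := hne
        have hδ : ∀ i : Fin (m + 2), δ (Fin.castAdd 1 i) = δ 0 := fun i => h1 i 0
        have hε : ∀ i : Fin (m + 2), ε (Fin.castAdd 1 i) = ε 0 := fun i => h5 i 0
        have h0 : δ 0 = ε 0 := h2 0 (by simp) (by simp)
        have hδ' : ∀ i, δ i = δ 0 := Fin.addCases hδ fun j => by
          rw [h0, ← hε (Fin.last _), Subsingleton.elim j 0]
          exact h4
        have hε' : ∀ i, ε i = ε 0 := Fin.addCases hε fun j => by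
          rw [← h0, ← hδ (Fin.last _), Subsingleton.elim j 0]
          exact h3.symm
        exact h ⟨funext fun i => by rw [hδ', hε', h0], fun i j => by rw [hδ', hδ' j]⟩

lemma tP_eq {m : ℕ} (hm : 1 ≤ m) : tP m = constProj m := by
  obtain ⟨k, rfl⟩ := Nat.exists_eq_add_of_le' hm
  exact tP_succ k

lemma tHat_eq (k : ℕ) : tHat k = constProj k := by
  cases k with
  | zero => rw [constProj_eq_one zero_le_one, tHat]
  | succ k => exact tP_succ k

lemma eP_eq {m n : ℕ} (hmn : 3 ≤ m + n) : eP m n =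
    -(tensMor (tP m) (tP n) * atPos (m + n) (m - 1) (cupM * capM) *
      tensMor (tP m) (tP n)) := by
  rw [eP]
  rintro rfl rfl
  omega

lemma eq_blockSgn_iff {m n : ℕ} (ε : Sgn (m + n)) (a b : Bool) :
    ε = blockSgn m n a b ↔
      (∀ i, ε (Fin.castAdd n i) = a) ∧ ∀ j, ε (Fin.natAdd m j) = b := by
  simp [funext_iff, blockSgn, Fin.forall_fin_add]

lemma tensMor_constProj (m n : ℕ) : tensMor (constProj m) (constProj n) =
    Matrix.diagonal fun ε : Sgn (m + n) =>
      if ∃ a b, ε = blockSgn m n a b then 1 else 0 := by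
  rw [constProj, constProj, tensMor_diagonal]
  congr 1
  funext ε
  simp only [exists_eq_const_iff, eq_blockSgn_iff, exists_and_left, exists_and_right, ite_and,
    ite_mul, one_mul, zero_mul]

lemma diagonal_mul_mul_diagonal_congr {ι : Type*} [Fintype ι] [DecidableEq ι] {p : ι → Prop}
    [DecidablePred p] {A B : Matrix ι ι ℂ} (h : ∀ δ ε, p δ → p ε → A δ ε = B δ ε) :
    Matrix.diagonal (fun i => if p i then (1 : ℂ) else 0) * A *
        Matrix.diagonal (fun i => if p i then (1 : ℂ) else 0) =
      Matrix.diagonal (fun i => if p i then (1 : ℂ) else 0) * B *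
        Matrix.diagonal (fun i => if p i then (1 : ℂ) else 0) := by
  ext δ ε
  simp only [Matrix.mul_diagonal, Matrix.diagonal_mul]
  by_cases h1 : p δ <;> by_cases h2 : p ε <;> simp [h1, h2, h]

lemma cupc_mul_capc (a b c d : Bool) (P : Prop) [Decidable P] (r : ℕ) (hr : 1 ≤ r)
    (h : P → a = c ∨ b = d) (h' : a = c → b = d → P) :
    (if P then 1 else 0) * (cupc a b ^ r * capc c d ^ r) =
      if a = c ∧ b = d ∧ a ≠ b then (-1) ^ r else 0 := by
  have hr0 : r ≠ 0 := by omega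
  cases a <;> cases b <;> cases c <;> cases d <;> simp_all [cupc, capc]

lemma atPos_blockSgn {m n : ℕ} (hm : 1 ≤ m) (hn : 1 ≤ n) (hmn : 3 ≤ m + n) (a b c d : Bool) :
    atPos (m + n) (m - 1) (cupM * capM) (blockSgn m n a b) (blockSgn m n c d) =
      if a = c ∧ b = d ∧ a ≠ b then -1 else 0 := by
  have hle : m - 1 + 2 ≤ m + n := by omega
  simp only [atPos, Matrix.of_apply, hle, dite_true]
  have key := cupc_mul_capc a b c d (∀ k : Fin (m + n), k.val ≠ m - 1 → k.val ≠ m - 1 + 1 →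
    blockSgn m n a b k = blockSgn m n c d k) 1 le_rfl ?_ ?_
  · simpa [Matrix.mul_apply, cupM, capM, blockSgn, show 0 < m from hm,
      Nat.sub_add_cancel hm] using key
  · intro h
    by_cases h2 : 2 ≤ m
    · left
      simpa [blockSgn, show 0 < m by omega] using
        h ⟨0, by omega⟩ (by simp; omega) (by simp)
    · right
      simpa [blockSgn] using h ⟨m + 1, by omega⟩ (by simp; omega) (by simp; omega)
  · rintro rfl rfl
    simp

lemma nested_blockSgn {m n r : ℕ} (hr1 : 1 ≤ r) (hr2 : r ≤ min m n) (hr3 : r < max m n)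
    (h : m - r + (r + r) + (n - r) = m + n) (a b c d : Bool) :
    (rc h h (tensMor (tensMor (tHat (m - r)) (CuM r * CaM r)) (tHat (n - r))) : Op (m + n))
        (blockSgn m n a b) (blockSgn m n c d) =
      if a = c ∧ b = d ∧ a ≠ b then (-1) ^ r else 0 := by
  obtain ⟨hrm, hrn⟩ := le_min_iff.mp hr2
  have hcast : ∀ a b, (sgnCast h).symm (blockSgn m n a b) =
      fun i => if i.val < m then a else b := fun a b => rfl
  have hcu : ∀ a b x, CuM r (fun i => if m - r + i.val < m then a else b) x =
      cupc a b ^ r := fun a b x => by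
    rw [CuM, Matrix.of_apply, ← Fin.prod_const]
    refine Finset.prod_congr rfl fun k _ => ?_
    have h1 : m - r + k.val < m := by omega
    have h2 : ¬ m - r + (r + r - 1 - k.val) < m := by omega
    simp only [h1, h2, if_true, if_false]
  have hca : ∀ a b x, CaM r x (fun i => if m - r + i.val < m then a else b) =
      capc a b ^ r := fun a b x => by
    rw [CaM, Matrix.of_apply, ← Fin.prod_const]
    refine Finset.prod_congr rfl fun k _ => ?_
    have h1 : m - r + k.val < m := by omega
    have h2 : ¬ m - r + (r + r - 1 - k.val) < m := by omega
    simp only [h1, h2, if_true, if_false]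
  have hfst : ∀ i : Fin (m - r), i.val < m := fun i => by omega
  have hsnd : ∀ j : Fin (n - r), ¬ m - r + (r + r) + j.val < m := fun j => by omega
  rw [rc, Matrix.reindex_apply, Matrix.submatrix_apply, hcast, hcast]
  simp only [tensMor, Matrix.of_apply, tHat_eq, constProj_apply, Matrix.mul_apply,
    Fintype.sum_unique, Fin.val_castAdd, Fin.val_natAdd, hcu, hca, hfst, hsnd, if_true, if_false,
    implies_true, and_true]
  rw [mul_right_comm, mul_ite, mul_one, mul_zero, ← ite_and]
  apply cupc_mul_capc _ _ _ _ _ _ hr1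
  · rintro ⟨h2, h1⟩
    rcases lt_max_iff.mp hr3 with hlt | hlt
    · exact Or.inl (congrFun h1 ⟨0, by omega⟩)
    · exact Or.inr (congrFun h2 ⟨0, by omega⟩)
  · rintro rfl rfl
    exact ⟨rfl, rfl⟩

/-- Alternative expression for `e_{m,n}`:
`e_{m,n} = (-1)^r (t_m ⊗ t_n) ∘ (t_{m-r} ⊗ Cu_r Ca_r ⊗ t_{n-r}) ∘ (t_m ⊗ t_n)`. -/
theorem eP_alternative (m n r : ℕ) (hm : 1 ≤ m) (hn : 1 ≤ n) (hmn : 3 ≤ m + n)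
    (hr1 : 1 ≤ r) (hr2 : r ≤ min m n) (hr3 : r < max m n) :
    eP m n = (-1 : ℂ) ^ r •
      (tensMor (tP m) (tP n) *
        (rc (by omega) (by omega)
          (tensMor (tensMor (tHat (m - r)) (CuM r * CaM r)) (tHat (n - r))) :
            Op (m + n)) *
        tensMor (tP m) (tP n)) := by
  rw [eP_eq hmn, tP_eq hm, tP_eq hn, tensMor_constProj, ← Matrix.neg_mul, ← Matrix.mul_neg,
    ← Matrix.smul_mul, ← Matrix.mul_smul]
  apply diagonal_mul_mul_diagonal_congr
  rintro _ _ ⟨a, b, rfl⟩ ⟨c, d, rfl⟩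
  rw [Matrix.neg_apply, Matrix.smul_apply, atPos_blockSgn hm hn hmn,
    nested_blockSgn hr1 hr2 hr3]
  split_ifs <;> simp [← mul_pow]
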